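/- arXiv:2205.04990 — 10 statements merged into one kernel-verified Lean document; each statement's English description precedes it below -/
import Mathlib

section
/- Let (G,S) be a finite game of incomplete information and let ν : E × T × A → ℝ. Then the following are equivalent: (i) there exists a Bayes stable equilibrium σ of (G,S) such that ν(ε,t,a) = ψ(ε)·π(t|ε)·σ(a|ε,t) for all (ε,t,a); (ii) there exists an expansion S* of S, given by finite nonempty sets T̃_i with T̃ = ∏_i T̃_i and an augmenting signal distribution λ : E × T → Δ(T̃), and a rational expectations equilibrium δ : T × T̃ → Δ(A) of (G,S*) such that ν(ε,t,a) = ∑_{t̃∈T̃} ψ(ε)·π(t|ε)·λ(t̃|ε,t)·δ(a|(t,t̃)) for all (ε,t,a). (Paper's Theorem 1, informational robustness: the set of joint distributions on E × T × A arising in a BSE of (G,S) equals the union over expansions S* of S of the joint distributions arising in an REE of (G,S*).) -/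
open Finset
open scoped Classical

noncomputable section

/-- The Bayes stable equilibrium obedience condition for a decision rule
`σ : E × T → Δ(A)` in the game `(G,S)` given by prior `ψ`, signal distribution `π`
and utilities `u`. -/
def IsBSE {I E : Type} {A T : I → Type} [Fintype I] [Fintype E]
    [∀ i, Fintype (A i)] [∀ i, Fintype (T i)]
    (ψ : E → ℝ) (π : E → (∀ i, T i) → ℝ)
    (u : I → (∀ j, A j) → E → ℝ)
    (σ : E → (∀ i, T i) → (∀ i, A i) → ℝ) : Prop :=
  ∀ (i : I) (ti : T i) (a : ∀ j, A j) (ai' : A i),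
    ∑ ε : E, ∑ t ∈ Finset.univ.filter (fun t : ∀ j, T j => t i = ti),
      ψ ε * π ε t * σ ε t a *
        (u i (Function.update a i ai') ε - u i a ε) ≤ 0

/-- A witness that the joint distribution `ν` on `E × T × A` arises in a rational
expectations equilibrium of `(G,S*)` for some expansion `S*` of `S`: it consists of finite
nonempty sets of extra signals `Tt i`, an augmenting signal distribution `lam`, and an
outcome function `delta` of the expanded game satisfying the rational expectations
equilibrium conditions and inducing `ν`. -/
structure ExpansionREEWitness (I E : Type) (A T : I → Type) [Fintype I] [Fintype E]
    [∀ i, Fintype (A i)] [∀ i, Fintype (T i)]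
    (ψ : E → ℝ) (π : E → (∀ i, T i) → ℝ)
    (u : I → (∀ j, A j) → E → ℝ)
    (ν : E → (∀ i, T i) → (∀ i, A i) → ℝ) : Type 1 where
  /-- the extra signal set of each player -/
  Tt : I → Type
  [finTt : ∀ i, Fintype (Tt i)]
  [neTt : ∀ i, Nonempty (Tt i)]
  /-- the augmenting signal distribution `λ : E × T → Δ(T̃)` -/
  lam : E → (∀ i, T i) → (∀ i, Tt i) → ℝ
  lam_nonneg : ∀ ε t tt, 0 ≤ lam ε t tt
  lam_sum : ∀ ε t, ∑ tt : ∀ i, Tt i, lam ε t tt = 1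
  /-- the outcome function `δ : T × T̃ → Δ(A)` of the expanded game -/
  delta : (∀ i, T i) → (∀ i, Tt i) → (∀ i, A i) → ℝ
  delta_nonneg : ∀ t tt a, 0 ≤ delta t tt a
  delta_sum : ∀ t tt, ∑ a : ∀ i, A i, delta t tt a = 1
  /-- `delta` is a rational expectations equilibrium of `(G,S*)`, where `S*` has signal
  sets `T i × Tt i` and signal distribution `π*((t,t̃)|ε) = π(t|ε)·λ(t̃|ε,t)` -/
  ree : ∀ (i : I) (ti : T i) (tti : Tt i) (a : ∀ j, A j) (ai' : A i),
    ∑ ε : E, ∑ t ∈ Finset.univ.filter (fun t : ∀ j, T j => t i = ti),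
      ∑ tt ∈ Finset.univ.filter (fun tt : ∀ j, Tt j => tt i = tti),
        ψ ε * π ε t * lam ε t tt * delta t tt a *
          (u i (Function.update a i ai') ε - u i a ε) ≤ 0
  /-- the induced joint distribution on `E × T × A` is `ν` -/
  repr : ∀ ε t a, ν ε t a = ∑ tt : ∀ i, Tt i, ψ ε * π ε t * lam ε t tt * delta t tt a

/-- **Theorem 1 of the paper (informational robustness).** A joint distribution `ν` on
`E × T × A` arises in a Bayes stable equilibrium of `(G,S)` if and only if it arises in a
rational expectations equilibrium of `(G,S*)` for some expansion `S*` of `S`. -/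
theorem bse_iff_expansion_ree {I E : Type} {A T : I → Type}
    [Fintype I] [Nonempty I] [Fintype E] [Nonempty E]
    [∀ i, Fintype (A i)] [∀ i, Nonempty (A i)]
    [∀ i, Fintype (T i)] [∀ i, Nonempty (T i)]
    (ψ : E → ℝ) (π : E → (∀ i, T i) → ℝ)
    (u : I → (∀ j, A j) → E → ℝ)
    (ν : E → (∀ i, T i) → (∀ i, A i) → ℝ)
    (hψpos : ∀ ε, 0 < ψ ε) (hψsum : ∑ ε : E, ψ ε = 1)
    (hπnn : ∀ ε t, 0 ≤ π ε t) (hπsum : ∀ ε, ∑ t : ∀ i, T i, π ε t = 1) :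
    (∃ σ : E → (∀ i, T i) → (∀ i, A i) → ℝ,
        (∀ ε t a, 0 ≤ σ ε t a) ∧ (∀ ε t, ∑ a : ∀ i, A i, σ ε t a = 1) ∧
        IsBSE ψ π u σ ∧ (∀ ε t a, ν ε t a = ψ ε * π ε t * σ ε t a))
      ↔ Nonempty (ExpansionREEWitness I E A T ψ π u ν) := by
  constructor
  · rintro ⟨σ, hσ0, hσ1, hB, hν⟩
    let i0 : I := Classical.arbitrary I
    let lam : E → (∀ i, T i) → (I → ∀ j, A j) → ℝ := fun ε t tt =>
      ∑ b : ∀ j, A j, if tt = (fun _ => b) then σ ε t b else 0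
    have key : ∀ ε t (F : (I → ∀ j, A j) → ℝ),
        ∑ tt : I → ∀ j, A j, lam ε t tt * F tt = ∑ b : ∀ j, A j, σ ε t b * F (fun _ => b) := by
      intro ε t F
      simp only [lam, Finset.sum_mul]
      rw [Finset.sum_comm]
      refine Finset.sum_congr rfl fun b _ => ?_
      simp [ite_mul]
    refine ⟨{ Tt := fun _ => ∀ j, A j
              lam := lam
              lam_nonneg := ?_
              lam_sum := ?_
              delta := fun _ tt a => if a = tt i0 then 1 else 0
              delta_nonneg := ?_
              delta_sum := ?_
              ree := ?_
              repr := ?_ }⟩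
    · intro ε t tt
      refine Finset.sum_nonneg fun b _ => ?_
      split_ifs
      · exact hσ0 ε t b
      · exact le_rfl
    · intro ε t
      have h := key ε t (fun _ => 1)
      simp only [mul_one] at h
      exact h.trans (hσ1 ε t)
    · intro t tt a
      split_ifs <;> norm_num
    · intro t tt
      simp
    · intro i ti tti a ai'
      have inner : ∀ ε t, ∑ tt ∈ Finset.univ.filter (fun tt : I → ∀ j, A j => tt i = tti),
          ψ ε * π ε t * lam ε t tt * (if a = tt i0 then 1 else 0) *
            (u i (Function.update a i ai') ε - u i a ε)
          = if a = tti then ψ ε * π ε t * σ ε t a *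
            (u i (Function.update a i ai') ε - u i a ε) else 0 := by
        intro ε t
        have h := key ε t (fun tt => if tt i = tti then ψ ε * π ε t * (if a = tt i0 then 1 else 0) *
            (u i (Function.update a i ai') ε - u i a ε) else 0)
        rw [Finset.sum_filter]
        refine Eq.trans (Finset.sum_congr rfl fun tt _ => ?_) (h.trans ?_)
        · split_ifs <;> ring
        · rw [Finset.sum_eq_single a]
          · by_cases h' : a = tti
            · rw [if_pos h', if_pos h', if_pos rfl]
              ring
            · rw [if_neg h', if_neg h', mul_zero]
          · intro b _ hb
            simp [hb.symm]
          · simp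
      refine le_of_eq_of_le (b := ∑ ε : E, ∑ t ∈ Finset.univ.filter (fun t : ∀ j, T j => t i = ti),
        if a = tti then ψ ε * π ε t * σ ε t a *
            (u i (Function.update a i ai') ε - u i a ε) else 0) (Finset.sum_congr rfl fun ε _ =>
        Finset.sum_congr rfl fun t _ => ?_) ?_
      · convert inner ε t
      by_cases h : a = tti
      · simp only [h, if_true]
        exact hB i ti tti ai'
      · simp [h]
    · intro ε t a
      have h := key ε t (fun tt => ψ ε * π ε t * (if a = tt i0 then 1 else 0))
      rw [hν]
      refine Eq.trans ?_ (h.symm.trans (Finset.sum_congr rfl fun tt _ => ?_))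
      · rw [Finset.sum_eq_single a]
        · simp; ring
        · intro b _ hb
          simp [hb.symm]
        · simp
      · ring
  · rintro ⟨W⟩
    obtain ⟨Tt, lam, hl0, hl1, delta, hd0, hd1, hree, hrepr⟩ := W
    refine ⟨fun ε t a => ∑ tt, lam ε t tt * delta t tt a, ?_, ?_, ?_, ?_⟩
    · intro ε t a
      exact Finset.sum_nonneg fun tt _ => mul_nonneg (hl0 _ _ _) (hd0 _ _ _)
    · intro ε t
      rw [Finset.sum_comm]
      simp only [← Finset.mul_sum, hd1, mul_one, hl1]
    · intro i ti a ai'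
      have h := Finset.sum_nonpos (s := Finset.univ) fun tti _ => hree i ti tti a ai'
      refine le_of_eq_of_le (Eq.symm ?_) h
      rw [Finset.sum_comm]
      refine Finset.sum_congr rfl fun ε _ => ?_
      rw [Finset.sum_comm]
      refine Finset.sum_congr rfl fun t _ => ?_
      refine (Finset.sum_fiberwise Finset.univ (fun tt : ∀ j, Tt j => tt i) _).trans ?_
      rw [Finset.mul_sum, Finset.sum_mul]
      refine Finset.sum_congr rfl fun tt _ => ?_
      ring
    · intro ε t a
      rw [hrepr, Finset.mul_sum]
      refine Finset.sum_congr rfl fun tt _ => ?_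
      ring
end
end

section
/- Let (G,S) be a finite game of incomplete information and let φ ∈ Δ(A) (i.e. φ(a) ≥ 0 and ∑_{a∈A} φ(a) = 1). Then the following are equivalent: (i) there exists a Bayes stable equilibrium σ of (G,S) inducing φ, i.e. φ(a) = ∑_{ε∈E} ∑_{t∈T} ψ(ε)·π(t|ε)·σ(a|ε,t) for all a ∈ A; (ii) there exists an expansion S* of S, given by finite nonempty sets T̃_i with T̃ = ∏_i T̃_i and an augmenting signal distribution λ : E × T → Δ(T̃), and a rational expectations equilibrium δ : T × T̃ → Δ(A) of (G,S*) inducing φ, i.e. φ(a) = ∑_{ε∈E} ∑_{t∈T} ∑_{t̃∈T̃} ψ(ε)·π(t|ε)·λ(t̃|ε,t)·δ(a|(t,t̃)) for all a ∈ A. (Paper's Corollary 1, observational equivalence: the marginal distributions over action profiles arising in BSE of (G,S) are exactly those arising in REE of some expansion of S.) -/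
open Finset
open scoped Classical

noncomputable section

/-- A witness that the distribution `φ ∈ Δ(A)` over action profiles arises in a rational
expectations equilibrium of `(G,S*)` for some expansion `S*` of `S`: it consists of finite
nonempty sets of extra signals `Tt i`, an augmenting signal distribution `lam`, and an
outcome function `delta` of the expanded game satisfying the rational expectations
equilibrium conditions and inducing `φ`. -/
structure ExpansionREEMarginalWitness (I E : Type) (A T : I → Type) [Fintype I] [Fintype E]
    [∀ i, Fintype (A i)] [∀ i, Fintype (T i)]
    (ψ : E → ℝ) (π : E → (∀ i, T i) → ℝ)
    (u : I → (∀ j, A j) → E → ℝ)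
    (φ : (∀ i, A i) → ℝ) : Type 1 where
  /-- the extra signal set of each player -/
  Tt : I → Type
  [finTt : ∀ i, Fintype (Tt i)]
  [neTt : ∀ i, Nonempty (Tt i)]
  /-- the augmenting signal distribution `λ : E × T → Δ(T̃)` -/
  lam : E → (∀ i, T i) → (∀ i, Tt i) → ℝ
  lam_nonneg : ∀ ε t tt, 0 ≤ lam ε t tt
  lam_sum : ∀ ε t, ∑ tt : ∀ i, Tt i, lam ε t tt = 1
  /-- the outcome function `δ : T × T̃ → Δ(A)` of the expanded game -/
  delta : (∀ i, T i) → (∀ i, Tt i) → (∀ i, A i) → ℝ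
  delta_nonneg : ∀ t tt a, 0 ≤ delta t tt a
  delta_sum : ∀ t tt, ∑ a : ∀ i, A i, delta t tt a = 1
  /-- `delta` is a rational expectations equilibrium of `(G,S*)`, where `S*` has signal
  sets `T i × Tt i` and signal distribution `π*((t,t̃)|ε) = π(t|ε)·λ(t̃|ε,t)` -/
  ree : ∀ (i : I) (ti : T i) (tti : Tt i) (a : ∀ j, A j) (ai' : A i),
    ∑ ε : E, ∑ t ∈ Finset.univ.filter (fun t : ∀ j, T j => t i = ti),
      ∑ tt ∈ Finset.univ.filter (fun tt : ∀ j, Tt j => tt i = tti),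
        ψ ε * π ε t * lam ε t tt * delta t tt a *
          (u i (Function.update a i ai') ε - u i a ε) ≤ 0
  /-- the induced marginal distribution over action profiles is `φ` -/
  induces : ∀ a, φ a = ∑ ε : E, ∑ t : ∀ i, T i, ∑ tt : ∀ i, Tt i,
    ψ ε * π ε t * lam ε t tt * delta t tt a

/-- **Corollary 1 of the paper (observational equivalence).** A distribution
`φ ∈ Δ(A)` over action profiles is induced by some Bayes stable equilibrium of `(G,S)`
if and only if it is induced by a rational expectations equilibrium of `(G,S*)` for
some expansion `S*` of `S`. -/
theorem bse_marginal_iff_expansion_ree_marginal {I E : Type} {A T : I → Type}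
    [Fintype I] [Nonempty I] [Fintype E] [Nonempty E]
    [∀ i, Fintype (A i)] [∀ i, Nonempty (A i)]
    [∀ i, Fintype (T i)] [∀ i, Nonempty (T i)]
    (ψ : E → ℝ) (π : E → (∀ i, T i) → ℝ)
    (u : I → (∀ j, A j) → E → ℝ)
    (φ : (∀ i, A i) → ℝ)
    (hψpos : ∀ ε, 0 < ψ ε) (hψsum : ∑ ε : E, ψ ε = 1)
    (hπnn : ∀ ε t, 0 ≤ π ε t) (hπsum : ∀ ε, ∑ t : ∀ i, T i, π ε t = 1)
    (hφnn : ∀ a, 0 ≤ φ a) (hφsum : ∑ a : ∀ i, A i, φ a = 1) :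
    (∃ σ : E → (∀ i, T i) → (∀ i, A i) → ℝ,
        (∀ ε t a, 0 ≤ σ ε t a) ∧ (∀ ε t, ∑ a : ∀ i, A i, σ ε t a = 1) ∧
        IsBSE ψ π u σ ∧
        (∀ a, φ a = ∑ ε : E, ∑ t : ∀ i, T i, ψ ε * π ε t * σ ε t a))
      ↔ Nonempty (ExpansionREEMarginalWitness I E A T ψ π u φ) := by
  constructor
  · rintro ⟨σ, hnn, hsum, hbse, hind⟩
    obtain ⟨i₀⟩ := ‹Nonempty I›
    have key : ∀ (ε : E) (t : ∀ i, T i) (a : ∀ i, A i) (P : (I → ∀ i, A i) → Prop),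
        ∑ tt : I → (∀ i, A i), (if P tt then
          (∑ b : ∀ i, A i, if tt = (fun _ => b) then σ ε t b else 0)
            * (if a = tt i₀ then (1 : ℝ) else 0) else 0)
        = if P (fun _ => a) then σ ε t a else 0 := by
      intro ε t a P
      rw [Finset.sum_eq_single (fun _ => a)]
      · have : ∀ b : ∀ i, A i, ((fun _ : I => a) = fun _ => b) ↔ a = b := fun b =>
          ⟨fun h => congrFun h i₀, fun h => by rw [h]⟩
        simp [this]
      · intro tt _ hne
        split_ifs with h1 h2
        · rw [Finset.sum_eq_zero, zero_mul]
          intro b _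
          rw [if_neg]
          rintro rfl
          exact hne (by rw [h2])
        · simp
        · rfl
      · simp
    refine ⟨{
      Tt := fun _ => ∀ i, A i
      lam := fun ε t tt => ∑ b : ∀ i, A i, if tt = (fun _ => b) then σ ε t b else 0
      lam_nonneg := ?_
      lam_sum := ?_
      delta := fun t tt a => if a = tt i₀ then 1 else 0
      delta_nonneg := ?_
      delta_sum := ?_
      ree := ?_
      induces := ?_ }⟩
    · intro ε t tt
      refine Finset.sum_nonneg fun b _ => ?_
      split_ifs
      · exact hnn ε t b
      · exact le_rfl
    · intro ε t
      rw [Finset.sum_comm]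
      simpa using hsum ε t
    · intro t tt a
      split_ifs <;> norm_num
    · intro t tt
      simp
    · intro i ti tti a ai'
      have h : ∀ (ε : E) (t : ∀ i, T i),
          ∑ tt ∈ Finset.univ.filter (fun tt : I → (∀ i, A i) => tt i = tti),
            ψ ε * π ε t * (∑ b : ∀ i, A i, if tt = (fun _ => b) then σ ε t b else 0)
              * (if a = tt i₀ then (1 : ℝ) else 0)
              * (u i (Function.update a i ai') ε - u i a ε)
          = if a = tti then ψ ε * π ε t * σ ε t a *
              (u i (Function.update a i ai') ε - u i a ε) else 0 := by
        intro ε t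
        have hk : ∑ tt ∈ Finset.univ.filter (fun tt : I → (∀ i, A i) => tt i = tti),
              (∑ b : ∀ i, A i, if tt = (fun _ => b) then σ ε t b else 0)
              * (if a = tt i₀ then (1 : ℝ) else 0) = if a = tti then σ ε t a else 0 := by
          rw [Finset.sum_filter]
          convert key ε t a (fun tt => tt i = tti)
        calc _ = ψ ε * π ε t * (∑ tt ∈ Finset.univ.filter
              (fun tt : I → (∀ i, A i) => tt i = tti),
              (∑ b : ∀ i, A i, if tt = (fun _ => b) then σ ε t b else 0)
              * (if a = tt i₀ then (1 : ℝ) else 0))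
              * (u i (Function.update a i ai') ε - u i a ε) := by
                rw [Finset.mul_sum, Finset.sum_mul]
                refine Finset.sum_congr rfl fun tt _ => ?_
                rw [mul_assoc (ψ ε * π ε t)]
          _ = _ := by
                rw [hk]
                split_ifs <;> simp
      refine le_trans (b := ∑ ε : E, ∑ t ∈ Finset.univ.filter (fun t : ∀ j, T j => t i = ti),
        if a = tti then ψ ε * π ε t * σ ε t a *
              (u i (Function.update a i ai') ε - u i a ε) else 0)
        (le_of_eq (Finset.sum_congr rfl fun ε _ =>
        Finset.sum_congr rfl fun t _ => by convert h ε t)) ?_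
      by_cases hc : a = tti
      · simp only [if_pos hc]
        exact hbse i ti a ai'
      · simp [hc]
    · intro a
      rw [hind a]
      refine Finset.sum_congr rfl fun ε _ => Finset.sum_congr rfl fun t _ => ?_
      have hk := key ε t a (fun _ => True)
      simp only [if_true] at hk
      rw [← hk, Finset.mul_sum]
      refine Finset.sum_congr rfl fun tt _ => ?_
      rw [mul_assoc (ψ ε * π ε t)]
  · rintro ⟨w⟩
    obtain ⟨Tt, lam, lnn, lsum, delta, dnn, dsum, ree, hind⟩ := w
    refine ⟨fun ε t a => ∑ tt, lam ε t tt * delta t tt a, ?_, ?_, ?_, ?_⟩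
    · exact fun ε t a => Finset.sum_nonneg fun tt _ => mul_nonneg (lnn _ _ _) (dnn _ _ _)
    · intro ε t
      rw [Finset.sum_comm]
      simp only [← Finset.mul_sum, dsum, mul_one, lsum]
    · intro i ti a ai'
      have h := Finset.sum_nonpos (s := Finset.univ) fun tti _ => ree i ti tti a ai'
      refine le_trans (le_of_eq ?_) h
      refine Eq.trans ?_ Finset.sum_comm
      refine Finset.sum_congr rfl fun ε _ => ?_
      refine Eq.trans ?_ Finset.sum_comm
      refine Finset.sum_congr rfl fun t _ => ?_
      refine Eq.trans ?_ (Finset.sum_fiberwise Finset.univ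
        (fun tt : ∀ j, Tt j => tt i) _).symm
      rw [Finset.mul_sum, Finset.sum_mul]
      refine Finset.sum_congr rfl fun tt _ => ?_
      ring
    · intro a
      rw [hind a]
      refine Finset.sum_congr rfl fun ε _ => Finset.sum_congr rfl fun t _ => ?_
      rw [Finset.mul_sum]
      refine Finset.sum_congr rfl fun tt _ => ?_
      ring
end
end

section
/- Let G be a finite basic game with private values and full-support prior, and let δ : E → Δ(A). Then δ satisfies the REE condition of (G,S^private) — for every i ∈ I, e_i ∈ E_i, a ∈ A and a_i' ∈ A_i, ∑_{ε∈E with ε_i = e_i} ψ(ε)·δ(a|ε)·(v_i((a_i',a_{-i}),e_i) − v_i(a,e_i)) ≤ 0 — if and only if δ satisfies the complete-information REE condition — for every i ∈ I, ε ∈ E, a ∈ A and a_i' ∈ A_i, ψ(ε)·δ(a|ε)·(v_i((a_i',a_{-i}),ε_i) − v_i(a,ε_i)) ≤ 0. (Paper's Theorem 2.2, first claim: with player-specific payoff shocks, an outcome function is a rational expectations equilibrium under private information if and only if it is one under complete information.) -/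
open Finset
open scoped Classical

noncomputable section

/-- **Theorem 2.2 of the paper, first claim.** In a finite basic game with private values
(state `ε = (ε_1,…,ε_I)` and utilities `u_i(a,ε) = v_i(a,ε_i)`), an outcome function
`δ : E → Δ(A)` satisfies the rational expectations equilibrium condition of
`(G, S^private)` if and only if it satisfies the rational expectations equilibrium
condition of `(G, S^complete)`. -/
theorem privateValues_ree_private_iff_ree_complete {I : Type} {A Ei : I → Type}
    [Fintype I] [Nonempty I]
    [∀ i, Fintype (A i)] [∀ i, Nonempty (A i)]
    [∀ i, Fintype (Ei i)] [∀ i, Nonempty (Ei i)]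
    (ψ : (∀ i, Ei i) → ℝ)
    (hψpos : ∀ ε, 0 < ψ ε) (hψsum : ∑ ε : ∀ i, Ei i, ψ ε = 1)
    (v : ∀ i : I, (∀ j, A j) → Ei i → ℝ)
    (δ : (∀ i, Ei i) → (∀ i, A i) → ℝ)
    (hδnn : ∀ ε a, 0 ≤ δ ε a) (hδsum : ∀ ε, ∑ a : ∀ i, A i, δ ε a = 1) :
    (∀ (i : I) (ei : Ei i) (a : ∀ j, A j) (ai' : A i),
        ∑ ε ∈ Finset.univ.filter (fun ε : ∀ j, Ei j => ε i = ei),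
          ψ ε * δ ε a * (v i (Function.update a i ai') ei - v i a ei) ≤ 0)
      ↔ (∀ (i : I) (ε : ∀ j, Ei j) (a : ∀ j, A j) (ai' : A i),
          ψ ε * δ ε a * (v i (Function.update a i ai') (ε i) - v i a (ε i)) ≤ 0) := by
  constructor
  · intro h i ε a ai'
    by_contra hc
    push Not at hc
    have hw : 0 ≤ ψ ε * δ ε a := mul_nonneg (hψpos ε).le (hδnn ε a)
    have hd : 0 < v i (Function.update a i ai') (ε i) - v i a (ε i) :=
      pos_of_mul_pos_right hc hw
    have hs := Finset.sum_pos' (s := Finset.univ.filter (fun η : ∀ j, Ei j => η i = ε i))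
      (f := fun η => ψ η * δ η a * (v i (Function.update a i ai') (ε i) - v i a (ε i)))
      (fun η _ => mul_nonneg (mul_nonneg (hψpos η).le (hδnn η a)) hd.le)
      ⟨ε, by simp, hc⟩
    exact absurd (h i (ε i) a ai') (not_le.mpr hs)
  · intro h i ei a ai'
    refine Finset.sum_nonpos fun ε hε => ?_
    obtain rfl : ε i = ei := (Finset.mem_filter.mp hε).2
    exact h i ε a ai'
end
end

section
/- Let X be a finite nonempty set of covariate values and Θ an arbitrary parameter set. For each x ∈ X and θ ∈ Θ, let (G^{x,θ},S^x) be a finite game of incomplete information (with common action profile set A, state set E, signal sets T^x, full-support prior ψ^{x,θ}, utilities u_i^{x,θ}, and signal distribution π^x), and let φ^x ∈ Δ(A) be observed conditional choice probabilities. Then for every θ ∈ Θ the following are equivalent: (i) for every x ∈ X there exist an expansion S̃^x of S^x (given by finite sets T̃^x and augmenting distribution λ^x : E × T^x → Δ(T̃^x)) and a rational expectations equilibrium δ^x of (G^{x,θ},S̃^x) with φ^x(a) = ∑_{ε,t,t̃} ψ^{x,θ}(ε)·π^x(t|ε)·λ^x(t̃|ε,t)·δ^x(a|(t,t̃)) for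 all a; (ii) for every x ∈ X there exists a Bayes stable equilibrium σ^x of (G^{x,θ},S^x) with φ^x(a) = ∑_{ε,t} ψ^{x,θ}(ε)·π^x(t|ε)·σ^x(a|ε,t) for all a. Consequently, the identified set of parameters under the assumption that the data are generated by an REE of some unknown expansion of the baseline information structure equals the identified set under the assumption that the data are generated by a BSE of the baseline information structure. (Paper's Theorem 4, equivalence of identified sets.) -/
open Finset
open scoped Classical

noncomputable section

theorem bse_of_witness {I E : Type} {A T : I → Type} [Fintype I] [Fintype E]
    [∀ i, Fintype (A i)] [∀ i, Fintype (T i)]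
    (ψ : E → ℝ) (π : E → (∀ i, T i) → ℝ)
    (u : I → (∀ j, A j) → E → ℝ)
    (φ : (∀ i, A i) → ℝ) (w : ExpansionREEMarginalWitness I E A T ψ π u φ) :
    ∃ σ : E → (∀ i, T i) → (∀ i, A i) → ℝ,
            (∀ ε t a, 0 ≤ σ ε t a) ∧ (∀ ε t, ∑ a : ∀ i, A i, σ ε t a = 1) ∧
            IsBSE ψ π u σ ∧
            ∀ a, φ a = ∑ ε : E, ∑ t : ∀ i, T i, ψ ε * π ε t * σ ε t a := by
  obtain ⟨Tt, lam, hl, hls, delta, hd, hds, ree, ind⟩ := w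
  refine ⟨fun ε t a => ∑ tt, lam ε t tt * delta t tt a, ?_, ?_, ?_, ?_⟩
  · intro ε t a
    exact Finset.sum_nonneg fun tt _ => mul_nonneg (hl _ _ _) (hd _ _ _)
  · intro ε t
    rw [Finset.sum_comm]
    simp_rw [← Finset.mul_sum, hds, mul_one]
    exact hls ε t
  · intro i ti a ai'
    have h := Finset.sum_nonpos (s := (Finset.univ : Finset (Tt i)))
      (fun tti _ => ree i ti tti a ai')
    rw [Finset.sum_comm] at h
    refine le_of_eq_of_le ?_ h
    refine Finset.sum_congr rfl fun ε _ => ?_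
    refine Eq.trans ?_ Finset.sum_comm
    refine Finset.sum_congr rfl fun t _ => ?_
    refine Eq.trans ?_ (Finset.sum_fiberwise Finset.univ (fun tt : ∀ j, Tt j => tt i) _).symm
    rw [Finset.mul_sum, Finset.sum_mul]
    refine Finset.sum_congr rfl fun tt _ => ?_
    ring
  · intro a
    rw [ind a]
    refine Finset.sum_congr rfl fun ε _ => Finset.sum_congr rfl fun t _ => ?_
    rw [Finset.mul_sum]
    exact Finset.sum_congr rfl fun tt _ => by ring

theorem witness_of_bse {I E : Type} {A T : I → Type} [Fintype I] [Fintype E]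
    [∀ i, Fintype (A i)] [∀ i, Nonempty (A i)] [∀ i, Fintype (T i)]
    (ψ : E → ℝ) (π : E → (∀ i, T i) → ℝ)
    (u : I → (∀ j, A j) → E → ℝ)
    (φ : (∀ i, A i) → ℝ)
    (h : ∃ σ : E → (∀ i, T i) → (∀ i, A i) → ℝ,
            (∀ ε t a, 0 ≤ σ ε t a) ∧ (∀ ε t, ∑ a : ∀ i, A i, σ ε t a = 1) ∧
            IsBSE ψ π u σ ∧
            ∀ a, φ a = ∑ ε : E, ∑ t : ∀ i, T i, ψ ε * π ε t * σ ε t a) :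
    Nonempty (ExpansionREEMarginalWitness I E A T ψ π u φ) := by
  obtain ⟨σ, hn, hs, hb, hi⟩ := h
  refine ⟨{ Tt := A, lam := σ, lam_nonneg := hn, lam_sum := hs,
            delta := fun _ tt a => if tt = a then 1 else 0,
            delta_nonneg := ?_, delta_sum := ?_, ree := ?_, induces := ?_ }⟩
  · intro t tt a
    split_ifs <;> norm_num
  · intro t tt
    simp
  · intro i ti tti a ai'
    by_cases hc : a i = tti
    · refine le_of_eq_of_le ?_ (hb i ti a ai')
      refine Finset.sum_congr rfl fun ε _ => Finset.sum_congr rfl fun t _ => ?_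
      rw [Finset.sum_eq_single a]
      · simp
      · intro b _ hba
        simp [hba]
      · intro hna
        simp [hc] at hna
    · refine le_of_eq ?_
      refine Finset.sum_eq_zero fun ε _ => Finset.sum_eq_zero fun t _ =>
        Finset.sum_eq_zero fun tt htt => ?_
      have hne : tt ≠ a := by
        rintro rfl
        simp at htt
        exact hc htt
      simp [hne]
  · intro a
    rw [hi a]
    refine Finset.sum_congr rfl fun ε _ => Finset.sum_congr rfl fun t _ => ?_
    simp

/-- **Theorem 4 of the paper (equivalence of identified sets).** For every parameter `θ`,
the data `(φ^x)_{x∈X}` are rationalized at each covariate value `x` by a rational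
expectations equilibrium of `(G^{x,θ}, S̃^x)` for some expansion `S̃^x` of the baseline
information structure `S^x` if and only if they are rationalized at each `x` by a Bayes
stable equilibrium of `(G^{x,θ}, S^x)`; consequently, the two identified sets of
parameters coincide. -/
theorem identifiedSet_ree_expansion_eq_identifiedSet_bse
    {X : Type} [Fintype X] [Nonempty X] {Θ : Type}
    {I : Type} [Fintype I] [Nonempty I]
    {A : I → Type} [∀ i, Fintype (A i)] [∀ i, Nonempty (A i)]
    {E : Type} [Fintype E] [Nonempty E]
    {T : X → I → Type} [∀ x i, Fintype (T x i)] [∀ x i, Nonempty (T x i)]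
    (ψ : X → Θ → E → ℝ)
    (hψpos : ∀ x θ ε, 0 < ψ x θ ε) (hψsum : ∀ x θ, ∑ ε : E, ψ x θ ε = 1)
    (u : ∀ x : X, Θ → I → (∀ j, A j) → E → ℝ)
    (π : ∀ x : X, E → (∀ i, T x i) → ℝ)
    (hπnn : ∀ x ε t, 0 ≤ π x ε t) (hπsum : ∀ x ε, ∑ t : ∀ i, T x i, π x ε t = 1)
    (φ : X → (∀ i, A i) → ℝ)
    (hφnn : ∀ x a, 0 ≤ φ x a) (hφsum : ∀ x, ∑ a : ∀ i, A i, φ x a = 1) :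
    (∀ θ : Θ,
      (∀ x : X, Nonempty (ExpansionREEMarginalWitness I E A (T x) (ψ x θ) (π x) (u x θ) (φ x)))
        ↔ (∀ x : X, ∃ σ : E → (∀ i, T x i) → (∀ i, A i) → ℝ,
            (∀ ε t a, 0 ≤ σ ε t a) ∧ (∀ ε t, ∑ a : ∀ i, A i, σ ε t a = 1) ∧
            IsBSE (ψ x θ) (π x) (u x θ) σ ∧
            ∀ a, φ x a = ∑ ε : E, ∑ t : ∀ i, T x i, ψ x θ ε * π x ε t * σ ε t a)) ∧
    {θ : Θ | ∀ x : X,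
        Nonempty (ExpansionREEMarginalWitness I E A (T x) (ψ x θ) (π x) (u x θ) (φ x))}
      = {θ : Θ | ∀ x : X, ∃ σ : E → (∀ i, T x i) → (∀ i, A i) → ℝ,
            (∀ ε t a, 0 ≤ σ ε t a) ∧ (∀ ε t, ∑ a : ∀ i, A i, σ ε t a = 1) ∧
            IsBSE (ψ x θ) (π x) (u x θ) σ ∧
            ∀ a, φ x a = ∑ ε : E, ∑ t : ∀ i, T x i, ψ x θ ε * π x ε t * σ ε t a} := by
  refine ⟨fun θ => ⟨fun h x => (h x).elim fun w => bse_of_witness _ _ _ _ w,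
      fun h x => witness_of_bse _ _ _ _ (h x)⟩, Set.ext fun θ =>
    ⟨fun h x => (h x).elim fun w => bse_of_witness _ _ _ _ w,
      fun h x => witness_of_bse _ _ _ _ (h x)⟩⟩
end
end

section
/- Let X be a finite nonempty set and Θ an arbitrary parameter set. For each x ∈ X and θ ∈ Θ, let G^{x,θ} be a finite basic game (with full-support prior ψ^{x,θ} and utilities u_i^{x,θ}), let S'^x and S''^x be information structures such that S'^x is an expansion of S''^x, and let φ^x ∈ Δ(A) be observed conditional choice probabilities. Define Θ_I^{BSE}(S) = {θ ∈ Θ : for every x ∈ X, there exists a Bayes stable equilibrium σ^x of (G^{x,θ},S^x) with φ^x(a) = ∑_{ε,t} ψ^{x,θ}(ε)·π^x(t|ε)·σ^x(a|ε,t) for all a}. Then Θ_I^{BSE}(S') ⊆ Θ_I^{BSE}(S''). (Paper's Theorem 5.1: a more informative baseline information structure yields a weakly tighter Bayes stable equilibrium identified set.) -/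
open Finset
open scoped Classical

noncomputable section

/-- Summing over profiles of pairs is summing over pairs of profiles. -/
theorem sum_pi_prod {I : Type} [Fintype I] {T U : I → Type}
    [∀ i, Fintype (T i)] [∀ i, Fintype (U i)] (F : (∀ i, T i × U i) → ℝ) :
    ∑ s, F s = ∑ t : ∀ i, T i, ∑ w : ∀ i, U i, F (fun i => (t i, w i)) := by
  rw [← Fintype.sum_prod_type' (f := fun (t : ∀ i, T i) (w : ∀ i, U i) =>
    F (fun i => (t i, w i)))]
  let e : (∀ i, T i × U i) ≃ (∀ i, T i) × (∀ i, U i) :=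
    { toFun := fun s => (fun i => (s i).1, fun i => (s i).2)
      invFun := fun p i => (p.1 i, p.2 i)
      left_inv := fun _ => rfl
      right_inv := fun _ => rfl }
  exact Fintype.sum_equiv e _ _ (fun _ => rfl)

/-- **Theorem 5.1 of the paper.** Suppose that at each covariate value `x`, the
information structure `S'^x` — with signal sets `T x i × Tt x i` and signal distribution
`π'((t,t̃)|ε) = π''(t|ε)·λ(t̃|ε,t)` — is an expansion of `S''^x` — with signal sets
`T x i` and signal distribution `π''`. Then the Bayes stable equilibrium identified set
of parameters under the baseline information structures `S'` is contained in the one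
under the baseline information structures `S''`. -/
theorem bse_identifiedSet_antitone
    {X : Type} [Fintype X] [Nonempty X] {Θ : Type}
    {I : Type} [Fintype I] [Nonempty I]
    {A : I → Type} [∀ i, Fintype (A i)] [∀ i, Nonempty (A i)]
    {E : X → Type} [∀ x, Fintype (E x)] [∀ x, Nonempty (E x)]
    {T : X → I → Type} [∀ x i, Fintype (T x i)] [∀ x i, Nonempty (T x i)]
    {Tt : X → I → Type} [∀ x i, Fintype (Tt x i)] [∀ x i, Nonempty (Tt x i)]
    (ψ : ∀ x : X, Θ → E x → ℝ)
    (hψpos : ∀ x θ ε, 0 < ψ x θ ε) (hψsum : ∀ x θ, ∑ ε : E x, ψ x θ ε = 1)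
    (u : ∀ x : X, Θ → I → (∀ j, A j) → E x → ℝ)
    (π'' : ∀ x : X, E x → (∀ i, T x i) → ℝ)
    (hπ''nn : ∀ x ε t, 0 ≤ π'' x ε t)
    (hπ''sum : ∀ x ε, ∑ t : ∀ i, T x i, π'' x ε t = 1)
    (lam : ∀ x : X, E x → (∀ i, T x i) → (∀ i, Tt x i) → ℝ)
    (hlamnn : ∀ x ε t tt, 0 ≤ lam x ε t tt)
    (hlamsum : ∀ x ε t, ∑ tt : ∀ i, Tt x i, lam x ε t tt = 1)
    (π' : ∀ x : X, E x → (∀ i, T x i × Tt x i) → ℝ)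
    (hπ' : ∀ x ε s, π' x ε s
      = π'' x ε (fun i => (s i).1) * lam x ε (fun i => (s i).1) (fun i => (s i).2))
    (φ : X → (∀ i, A i) → ℝ)
    (hφnn : ∀ x a, 0 ≤ φ x a) (hφsum : ∀ x, ∑ a : ∀ i, A i, φ x a = 1) :
    {θ : Θ | ∀ x : X, ∃ σ : E x → (∀ i, T x i × Tt x i) → (∀ i, A i) → ℝ,
        (∀ ε s a, 0 ≤ σ ε s a) ∧ (∀ ε s, ∑ a : ∀ i, A i, σ ε s a = 1) ∧
        IsBSE (ψ x θ) (π' x) (u x θ) σ ∧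
        ∀ a, φ x a = ∑ ε : E x, ∑ s : ∀ i, T x i × Tt x i, ψ x θ ε * π' x ε s * σ ε s a}
      ⊆ {θ : Θ | ∀ x : X, ∃ σ : E x → (∀ i, T x i) → (∀ i, A i) → ℝ,
        (∀ ε t a, 0 ≤ σ ε t a) ∧ (∀ ε t, ∑ a : ∀ i, A i, σ ε t a = 1) ∧
        IsBSE (ψ x θ) (π'' x) (u x θ) σ ∧
        ∀ a, φ x a = ∑ ε : E x, ∑ t : ∀ i, T x i, ψ x θ ε * π'' x ε t * σ ε t a} := by
  intro θ hθ x
  obtain ⟨σ, hnn, hsum, hB, hφ⟩ := hθ x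
  refine ⟨fun ε t a => ∑ w : ∀ i, Tt x i, lam x ε t w * σ ε (fun i => (t i, w i)) a,
    ?_, ?_, ?_, ?_⟩
  · intro ε t a
    exact Finset.sum_nonneg fun w _ => mul_nonneg (hlamnn _ _ _ _) (hnn _ _ _)
  · intro ε t
    rw [Finset.sum_comm]
    simp only [← Finset.mul_sum, hsum, mul_one, hlamsum]
  · intro i ti a ai'
    have key := Finset.sum_nonpos (s := (Finset.univ : Finset (Tt x i)))
      (fun wi _ => hB i (ti, wi) a ai')
    refine le_of_eq_of_le ?_ key
    symm
    rw [Finset.sum_comm]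
    symm
    have hε : ∀ (f g : E x → ℝ), (∀ ε, f ε = g ε) → ∑ ε, f ε = ∑ ε, g ε :=
      fun f g h => Finset.sum_congr rfl fun ε _ => h ε
    refine hε _ _ fun ε => ?_
    simp only [Finset.sum_filter]
    rw [Finset.sum_comm, sum_pi_prod]
    refine Finset.sum_congr rfl fun t _ => ?_
    by_cases h : t i = ti
    · simp only [h, if_true, hπ', Prod.mk.injEq, true_and, Finset.sum_ite_eq,
        Finset.mem_univ, Finset.mul_sum, Finset.sum_mul]
      refine Finset.sum_congr rfl fun w _ => ?_
      ring
    · simp [h]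
  · intro a
    rw [hφ a]
    refine Finset.sum_congr rfl fun ε _ => ?_
    rw [sum_pi_prod]
    refine Finset.sum_congr rfl fun t _ => ?_
    rw [Finset.mul_sum]
    refine Finset.sum_congr rfl fun w _ => ?_
    rw [hπ']
    ring
end
end

section
/- Let G be a finite basic game with private values and full-support prior, let S^complete be the information structure in which each player's signal set is E and π(t|ε) places probability 1 on the profile with t_i = ε for all i, and let S^private be the information structure in which player i's signal set is E_i and π(t|ε) places probability 1 on t = ε. Then the following three subsets of Δ(A) coincide: (i) {φ : φ is induced by some Bayes stable equilibrium of (G,S^complete)}; (ii) {φ : there exists σ : E → Δ(A) such that σ(a|ε) > 0 implies a is a pure strategy Nash equilibrium at ε, and φ(a) = ∑_{ε∈E} ψ(ε)·σ(a|ε) for all a}; (iii) {φ : φ is induced by some Bayes stable equilibrium of (G,S^private)}. (Paper's Theorem 5.2: Θ_I^{BSE}(S^complete) = Θ_I^{PSNE}(S^complete) = Θ_I^{BSE}(S^private).) -/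
open Finset
open scoped Classical

noncomputable section

/-- `a` is a pure strategy Nash equilibrium action profile at state `ε`. -/
def IsPSNE {I E : Type} {A : I → Type}
    (u : I → (∀ j, A j) → E → ℝ) (ε : E) (a : ∀ j, A j) : Prop :=
  ∀ (i : I) (ai' : A i), u i (Function.update a i ai') ε ≤ u i a ε

/-- The set of distributions over action profiles induced by some Bayes stable
equilibrium of `(G,S)`. -/
def bseActionDists {I E : Type} {A T : I → Type} [Fintype I] [Fintype E]
    [∀ i, Fintype (A i)] [∀ i, Fintype (T i)]
    (ψ : E → ℝ) (π : E → (∀ i, T i) → ℝ)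
    (u : I → (∀ j, A j) → E → ℝ) : Set ((∀ i, A i) → ℝ) :=
  {φ | ∃ σ : E → (∀ i, T i) → (∀ i, A i) → ℝ,
    (∀ ε t a, 0 ≤ σ ε t a) ∧ (∀ ε t, ∑ a : ∀ i, A i, σ ε t a = 1) ∧
    IsBSE ψ π u σ ∧
    ∀ a, φ a = ∑ ε : E, ∑ t : ∀ i, T i, ψ ε * π ε t * σ ε t a}

/-- The set of distributions over action profiles induced by some selection over pure
strategy Nash equilibrium outcomes. -/
def psneActionDists {I E : Type} {A : I → Type} [Fintype E]
    [∀ i, Fintype (A i)] [Fintype I]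
    (ψ : E → ℝ) (u : I → (∀ j, A j) → E → ℝ) : Set ((∀ i, A i) → ℝ) :=
  {φ | ∃ σ : E → (∀ i, A i) → ℝ,
    (∀ ε a, 0 ≤ σ ε a) ∧ (∀ ε, ∑ a : ∀ i, A i, σ ε a = 1) ∧
    (∀ ε a, 0 < σ ε a → IsPSNE u ε a) ∧
    ∀ a, φ a = ∑ ε : E, ψ ε * σ ε a}

/-- The complete information structure: each player's signal set is `E` and the signal
distribution places probability one on the profile in which every player observes the
realized state. -/
def piComplete {I E : Type} [Fintype I] : E → (I → E) → ℝ :=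
  fun ε t => if (∀ i, t i = ε) then 1 else 0

/-- The private information structure for a game with private values: player `i`'s
signal set is `Ei i` and the signal distribution places probability one on the signal
profile equal to the realized state. -/
def piPrivate {I : Type} {Ei : I → Type} : (∀ i, Ei i) → (∀ i, Ei i) → ℝ :=
  fun ε t => if t = ε then 1 else 0

lemma bse_eq_psne_of_deterministic {I E : Type} {A T : I → Type} [Fintype I] [Fintype E]
    [∀ i, Fintype (A i)] [∀ i, Fintype (T i)]
    (ψ : E → ℝ) (hψ : ∀ ε, 0 < ψ ε) (π : E → (∀ i, T i) → ℝ)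
    (u : I → (∀ j, A j) → E → ℝ) (s : E → ∀ i, T i)
    (hπ : ∀ ε t, π ε t = if t = s ε then 1 else 0)
    (hu : ∀ i a ε ε', s ε i = s ε' i → u i a ε = u i a ε') :
    bseActionDists ψ π u = psneActionDists ψ u := by
  have hsum : ∀ (σ : E → (∀ i, T i) → (∀ i, A i) → ℝ) a ε,
      ∑ t : ∀ i, T i, ψ ε * π ε t * σ ε t a = ψ ε * σ ε (s ε) a := by
    intro σ a ε
    rw [Finset.sum_eq_single (s ε)]
    · simp [hπ]
    · intro t _ ht
      simp [hπ, ht]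
    · simp
  ext φ
  constructor
  · rintro ⟨σ, h0, h1, hb, hφ⟩
    refine ⟨fun ε a => σ ε (s ε) a, fun ε a => h0 _ _ _, fun ε => h1 _ _, ?_, ?_⟩
    · intro ε a hpos i ai'
      by_contra hlt
      have hd : 0 < u i (Function.update a i ai') ε - u i a ε := by
        push Not at hlt
        linarith
      have hbi := hb i (s ε i) a ai'
      refine absurd hbi (not_le.mpr ?_)
      have hnn : ∀ ε', ∀ t ∈ Finset.univ.filter (fun t : ∀ j, T j => t i = s ε i),
          0 ≤ ψ ε' * π ε' t * σ ε' t a *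
            (u i (Function.update a i ai') ε' - u i a ε') := by
        intro ε' t ht
        have hti : t i = s ε i := (Finset.mem_filter.mp ht).2
        by_cases hts : t = s ε'
        · have he : s ε' i = s ε i := by rw [← hts]; exact hti
          rw [hu i _ ε' ε he, hu i a ε' ε he, hπ, if_pos hts, mul_one]
          exact mul_nonneg (mul_nonneg (hψ _).le (h0 _ _ _)) hd.le
        · simp [hπ, hts]
      refine Finset.sum_pos' (fun ε' _ => Finset.sum_nonneg (hnn ε')) ⟨ε, Finset.mem_univ _, ?_⟩
      refine Finset.sum_pos' (hnn ε) ⟨s ε, by simp, ?_⟩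
      rw [hπ, if_pos rfl, mul_one]
      exact mul_pos (mul_pos (hψ _) hpos) hd
    · intro a
      rw [hφ a]
      exact Finset.sum_congr rfl fun ε _ => hsum σ a ε
  · rintro ⟨σ, h0, h1, hp, hφ⟩
    refine ⟨fun ε _ a => σ ε a, fun ε _ a => h0 _ _, fun ε _ => h1 _, ?_, ?_⟩
    · intro i ti a ai'
      refine Finset.sum_nonpos fun ε _ => Finset.sum_nonpos fun t _ => ?_
      have hπ0 : 0 ≤ π ε t := by
        rw [hπ]
        split_ifs <;> norm_num
      rcases (h0 ε a).eq_or_lt with h | h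
      · simp [← h]
      · exact mul_nonpos_of_nonneg_of_nonpos
          (mul_nonneg (mul_nonneg (hψ _).le hπ0) h.le) (sub_nonpos.mpr (hp ε a h i ai'))
    · intro a
      rw [hφ a]
      exact Finset.sum_congr rfl fun ε _ => (hsum (fun ε _ a => σ ε a) a ε).symm

/-- **Theorem 5.2 of the paper.** In a finite basic game with private values, the
following three sets of action distributions coincide: those induced by Bayes stable
equilibria under complete information, those induced by selections over pure strategy
Nash equilibrium outcomes, and those induced by Bayes stable equilibria under private
information. -/
theorem bse_complete_eq_psne_eq_bse_private {I : Type} {A Ei : I → Type}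
    [Fintype I] [Nonempty I]
    [∀ i, Fintype (A i)] [∀ i, Nonempty (A i)]
    [∀ i, Fintype (Ei i)] [∀ i, Nonempty (Ei i)]
    (ψ : (∀ i, Ei i) → ℝ)
    (hψpos : ∀ ε, 0 < ψ ε) (hψsum : ∑ ε : ∀ i, Ei i, ψ ε = 1)
    (v : ∀ i : I, (∀ j, A j) → Ei i → ℝ) :
    bseActionDists (A := A) (T := fun _ : I => ∀ j, Ei j) ψ piComplete
        (fun i a ε => v i a (ε i))
      = psneActionDists (A := A) ψ (fun i a ε => v i a (ε i)) ∧
    psneActionDists (A := A) ψ (fun i a ε => v i a (ε i))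
      = bseActionDists (A := A) (T := Ei) ψ piPrivate (fun i a ε => v i a (ε i)) := by
  constructor
  · refine bse_eq_psne_of_deterministic ψ hψpos _ _ (fun ε _ => ε) ?_ ?_
    · intro ε t
      simp [piComplete, funext_iff]
    · intro i a ε ε' h
      exact congrArg (fun e : ∀ j, Ei j => v i a (e i)) h
  · symm
    refine bse_eq_psne_of_deterministic ψ hψpos _ _ (fun ε => ε) ?_ ?_
    · intro ε t
      simp [piPrivate]
    · intro i a ε ε' h
      exact congrArg (v i a) h
end
end

section
/- Let (G,S) be a finite game of incomplete information. Then every φ ∈ Δ(A) induced by some Bayes stable equilibrium of (G,S) is also induced by some Bayes correlated equilibrium of (G,S); that is, P_a^{BSE}(G,S) ⊆ P_a^{BCE}(G,S). Consequently, for any baseline information structure, the Bayes stable equilibrium identified set is contained in the Bayes correlated equilibrium identified set. (Paper's Theorem 5.3.) -/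
open Finset
open scoped Classical

noncomputable section

/-- The Bayes correlated equilibrium obedience condition for a decision rule
`σ : E × T → Δ(A)` in the game `(G,S)`. -/
def IsBCE {I E : Type} {A T : I → Type} [Fintype I] [Fintype E]
    [∀ i, Fintype (A i)] [∀ i, Fintype (T i)]
    (ψ : E → ℝ) (π : E → (∀ i, T i) → ℝ)
    (u : I → (∀ j, A j) → E → ℝ)
    (σ : E → (∀ i, T i) → (∀ i, A i) → ℝ) : Prop :=
  ∀ (i : I) (ti : T i) (ai ai' : A i),
    ∑ ε : E, ∑ t ∈ Finset.univ.filter (fun t : ∀ j, T j => t i = ti),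
      ∑ a ∈ Finset.univ.filter (fun a : ∀ j, A j => a i = ai),
        ψ ε * π ε t * σ ε t a *
          (u i (Function.update a i ai') ε - u i a ε) ≤ 0

/-- The set of distributions over action profiles induced by decision rules satisfying
an equilibrium condition `Eq` in the game `(G,S)`. -/
def inducedActionDists {I E : Type} {A T : I → Type} [Fintype I] [Fintype E]
    [∀ i, Fintype (A i)] [∀ i, Fintype (T i)]
    (ψ : E → ℝ) (π : E → (∀ i, T i) → ℝ)
    (Eq : (E → (∀ i, T i) → (∀ i, A i) → ℝ) → Prop) : Set ((∀ i, A i) → ℝ) :=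
  {φ | ∃ σ : E → (∀ i, T i) → (∀ i, A i) → ℝ,
    (∀ ε t a, 0 ≤ σ ε t a) ∧ (∀ ε t, ∑ a : ∀ i, A i, σ ε t a = 1) ∧ Eq σ ∧
    ∀ a, φ a = ∑ ε : E, ∑ t : ∀ i, T i, ψ ε * π ε t * σ ε t a}

/-- **Theorem 5.3 of the paper.** Every distribution over action profiles induced by a
Bayes stable equilibrium of `(G,S)` is induced by a Bayes correlated equilibrium of
`(G,S)`: `P_a^{BSE}(G,S) ⊆ P_a^{BCE}(G,S)`. -/
theorem bse_actionDists_subset_bce_actionDists {I E : Type} {A T : I → Type}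
    [Fintype I] [Nonempty I] [Fintype E] [Nonempty E]
    [∀ i, Fintype (A i)] [∀ i, Nonempty (A i)]
    [∀ i, Fintype (T i)] [∀ i, Nonempty (T i)]
    (ψ : E → ℝ) (hψpos : ∀ ε, 0 < ψ ε) (hψsum : ∑ ε : E, ψ ε = 1)
    (π : E → (∀ i, T i) → ℝ)
    (hπnn : ∀ ε t, 0 ≤ π ε t) (hπsum : ∀ ε, ∑ t : ∀ i, T i, π ε t = 1)
    (u : I → (∀ j, A j) → E → ℝ) :
    inducedActionDists (A := A) ψ π (IsBSE ψ π u)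
      ⊆ inducedActionDists (A := A) ψ π (IsBCE ψ π u) := by
  rintro φ ⟨σ, hnn, hsum, hσ, hφ⟩
  refine ⟨σ, hnn, hsum, ?_, hφ⟩
  intro i ti ai ai'
  have key : ∀ a : ∀ j, A j, _ := fun a => hσ i ti a ai'
  have h := Finset.sum_nonpos
    (s := Finset.univ.filter (fun a : ∀ j, A j => a i = ai)) (fun a _ => key a)
  rw [Finset.sum_comm] at h
  refine le_trans (le_of_eq ?_) h
  refine Finset.sum_congr rfl fun ε _ => ?_
  rw [Finset.sum_comm]
end
end

section
/- In the setting of the criterion-function program: let X be a finite nonempty set; for each x ∈ X let (G^x,S^x) be a finite game of incomplete information with full-support prior, let Φ be a nonempty closed subset of ∏_{x∈X} Δ(A) ⊆ ∏_{x∈X} ℝ^A, and let w^x > 0 for every x ∈ X. Define V = inf over the feasible set F (tuples (q,σ,φ) with q^x ≥ 0, σ^x a decision rule, φ ∈ Φ, obedience ∑_{ε,t_{-i}} ψ^x(ε)·π^x(t|ε)·σ^x(a|ε,t)·(u_i^x((a_i',a_{-i}),ε) − u_i^x(a,ε)) ≤ q^x for all i,t_i,a,a_i', and consistency φ^x(a)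 = ∑_{ε,t} ψ^x(ε)·π^x(t|ε)·σ^x(a|ε,t)) of the objective ∑_{x∈X} w^x·q^x. Then the infimum V is attained, and V = 0 if and only if there exists (σ^x)_{x∈X} such that each σ^x is a Bayes stable equilibrium of (G^x,S^x) and the induced family of action distributions (φ^x)_{x∈X}, φ^x(a) = ∑_{ε,t} ψ^x(ε)·π^x(t|ε)·σ^x(a|ε,t), belongs to Φ. (Paper's Theorem 8.2: the criterion function value is zero exactly when the parameter belongs to the confidence set.) -/
open Finset
open scoped Classical

noncomputable section

/-- The feasible set of the criterion-function program: tuples `(q, σ, φ)` where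
`q = (q^x) ∈ ℝ^X` is nonnegative, each `σ^x` is a decision rule, `φ = (φ^x) ∈ Φ`,
the obedience inequalities hold up to slack `q^x`, and `φ^x` is consistent with the
distribution over action profiles induced by `σ^x`. -/
def FeasibleSet {X : Type} {I : Type} {A : I → Type} {E : X → Type} {T : X → I → Type}
    [Fintype X] [Fintype I] [∀ i, Fintype (A i)]
    [∀ x, Fintype (E x)] [∀ x i, Fintype (T x i)]
    (ψ : ∀ x : X, E x → ℝ)
    (π : ∀ x : X, E x → (∀ i, T x i) → ℝ)
    (u : ∀ x : X, I → (∀ j, A j) → E x → ℝ)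
    (Φ : Set (X → (∀ i, A i) → ℝ)) :
    Set ((X → ℝ) × (∀ x : X, E x → (∀ i, T x i) → (∀ i, A i) → ℝ)
      × (X → (∀ i, A i) → ℝ)) :=
  {p | (∀ x, 0 ≤ p.1 x) ∧
    (∀ x ε t a, 0 ≤ p.2.1 x ε t a) ∧
    (∀ x ε t, ∑ a : ∀ i, A i, p.2.1 x ε t a = 1) ∧
    p.2.2 ∈ Φ ∧
    (∀ (x : X) (i : I) (ti : T x i) (a : ∀ j, A j) (ai' : A i),
      ∑ ε : E x, ∑ t ∈ Finset.univ.filter (fun t : ∀ j, T x j => t i = ti),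
        ψ x ε * π x ε t * p.2.1 x ε t a *
          (u x i (Function.update a i ai') ε - u x i a ε) ≤ p.1 x) ∧
    (∀ x a, p.2.2 x a = ∑ ε : E x, ∑ t : ∀ i, T x i, ψ x ε * π x ε t * p.2.1 x ε t a)}

/-- **Theorem 8.2 of the paper.** The infimum of the criterion-function program is
attained, and it equals zero if and only if there is a family of Bayes stable equilibria
`(σ^x)` whose induced conditional choice probabilities belong to the confidence set `Φ`. -/
theorem criterion_attained_and_zero_iff
    {X : Type} [Fintype X] [Nonempty X]
    {I : Type} [Fintype I] [Nonempty I]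
    {A : I → Type} [∀ i, Fintype (A i)] [∀ i, Nonempty (A i)]
    {E : X → Type} [∀ x, Fintype (E x)] [∀ x, Nonempty (E x)]
    {T : X → I → Type} [∀ x i, Fintype (T x i)] [∀ x i, Nonempty (T x i)]
    (ψ : ∀ x : X, E x → ℝ)
    (hψpos : ∀ x ε, 0 < ψ x ε) (hψsum : ∀ x, ∑ ε : E x, ψ x ε = 1)
    (π : ∀ x : X, E x → (∀ i, T x i) → ℝ)
    (hπnn : ∀ x ε t, 0 ≤ π x ε t) (hπsum : ∀ x ε, ∑ t : ∀ i, T x i, π x ε t = 1)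
    (u : ∀ x : X, I → (∀ j, A j) → E x → ℝ)
    (Φ : Set (X → (∀ i, A i) → ℝ)) (hΦne : Φ.Nonempty) (hΦclosed : IsClosed Φ)
    (hΦsub : ∀ φ ∈ Φ, ∀ x : X, (∀ a, 0 ≤ φ x a) ∧ ∑ a : ∀ i, A i, φ x a = 1)
    (w : X → ℝ) (hw : ∀ x, 0 < w x) :
    (∃ p ∈ FeasibleSet ψ π u Φ, ∀ p' ∈ FeasibleSet ψ π u Φ,
        ∑ x : X, w x * p.1 x ≤ ∑ x : X, w x * p'.1 x) ∧
      (sInf ((fun p => ∑ x : X, w x * p.1 x) '' FeasibleSet ψ π u Φ) = 0 ↔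
        ∃ σ : ∀ x : X, E x → (∀ i, T x i) → (∀ i, A i) → ℝ,
          (∀ x ε t a, 0 ≤ σ x ε t a) ∧ (∀ x ε t, ∑ a : ∀ i, A i, σ x ε t a = 1) ∧
          (∀ x, IsBSE (ψ x) (π x) (u x) (σ x)) ∧
          (fun (x : X) (a : ∀ i, A i) =>
            ∑ ε : E x, ∑ t : ∀ i, T x i, ψ x ε * π x ε t * σ x ε t a) ∈ Φ) := by
  have hne : (FeasibleSet ψ π u Φ).Nonempty := by
    obtain ⟨φ, hφ⟩ := hΦne
    have hb : ∀ x : X, ∃ c : ℝ, 0 ≤ c ∧ ∀ (i : I) (ti : T x i) (a : ∀ j, A j) (ai' : A i),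
        ∑ ε : E x, ∑ t ∈ Finset.univ.filter (fun t : ∀ j, T x j => t i = ti),
          ψ x ε * π x ε t * φ x a *
            (u x i (Function.update a i ai') ε - u x i a ε) ≤ c := by
      intro x
      obtain ⟨c, hc⟩ := (Set.finite_range
        (fun k : (Σ i : I, T x i × (∀ j, A j) × A i) =>
          ∑ ε : E x, ∑ t ∈ Finset.univ.filter (fun t : ∀ j, T x j => t k.1 = k.2.1),
          ψ x ε * π x ε t * φ x k.2.2.1 *
            (u x k.1 (Function.update k.2.2.1 k.1 k.2.2.2) ε - u x k.1 k.2.2.1 ε))).bddAbove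
      refine ⟨max c 0, le_max_right _ _, fun i ti a ai' => le_trans ?_ (le_max_left _ _)⟩
      exact hc ⟨⟨i, ti, a, ai'⟩, rfl⟩
    choose q hq0 hq using hb
    refine ⟨(q, fun x _ _ a => φ x a, φ), hq0, fun x _ _ a => (hΦsub φ hφ x).1 a,
      fun x _ _ => (hΦsub φ hφ x).2, hφ, hq, fun x a => ?_⟩
    have h1 : ∀ ε, ∑ t : ∀ i, T x i, ψ x ε * π x ε t * φ x a = ψ x ε * φ x a := by
      intro ε
      rw [← Finset.sum_mul, ← Finset.mul_sum, hπsum, mul_one]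
    simp only [h1]
    rw [← Finset.sum_mul, hψsum, one_mul]
  have hclosed : IsClosed (FeasibleSet ψ π u Φ) := by
    unfold FeasibleSet
    simp only [Set.setOf_and, Set.setOf_forall]
    refine IsClosed.inter ?_ (IsClosed.inter ?_ (IsClosed.inter ?_ (IsClosed.inter ?_
      (IsClosed.inter ?_ ?_))))
    · exact isClosed_iInter fun x => isClosed_le (by fun_prop) (by fun_prop)
    · exact isClosed_iInter fun x => isClosed_iInter fun ε => isClosed_iInter fun t =>
        isClosed_iInter fun a => isClosed_le (by fun_prop) (by fun_prop)
    · exact isClosed_iInter fun x => isClosed_iInter fun ε => isClosed_iInter fun t =>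
        isClosed_eq (by fun_prop) (by fun_prop)
    · exact hΦclosed.preimage (by fun_prop)
    · exact isClosed_iInter fun x => isClosed_iInter fun i => isClosed_iInter fun ti =>
        isClosed_iInter fun a => isClosed_iInter fun ai' =>
          isClosed_le (by fun_prop) (by fun_prop)
    · exact isClosed_iInter fun x => isClosed_iInter fun a =>
        isClosed_eq (by fun_prop) (by fun_prop)
  have hatt : ∃ p ∈ FeasibleSet ψ π u Φ, ∀ p' ∈ FeasibleSet ψ π u Φ,
      ∑ x : X, w x * p.1 x ≤ ∑ x : X, w x * p'.1 x := by
    obtain ⟨p0, hp0⟩ := hne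
    set V0 := ∑ x : X, w x * p0.1 x with hV0
    have hcont : Continuous (fun p : (X → ℝ) × (∀ x : X, E x → (∀ i, T x i) → (∀ i, A i) → ℝ)
      × (X → (∀ i, A i) → ℝ) => ∑ x : X, w x * p.1 x) := by fun_prop
    have hK : IsCompact (FeasibleSet ψ π u Φ ∩ {p | ∑ x : X, w x * p.1 x ≤ V0}) := by
      refine IsCompact.of_isClosed_subset
        (isCompact_Icc (a := ((fun _ => 0, fun _ _ _ _ => 0, fun _ _ => 0) :
          (X → ℝ) × (∀ x : X, E x → (∀ i, T x i) → (∀ i, A i) → ℝ) × (X → (∀ i, A i) → ℝ)))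
          (b := (fun x => V0 / w x, fun _ _ _ _ => 1, fun _ _ => 1)))
        (hclosed.inter (isClosed_le hcont continuous_const)) ?_
      rintro p ⟨⟨h1, h2, h3, h4, h5, h6⟩, hV⟩
      have hV' : ∑ x : X, w x * p.1 x ≤ V0 := hV
      refine ⟨⟨h1, h2, fun x => (hΦsub _ h4 x).1⟩, ⟨fun x => ?_, fun x ε t a => ?_,
        fun x a => ?_⟩⟩
      · show p.1 x ≤ V0 / w x
        rw [le_div_iff₀ (hw x), mul_comm]
        exact (Finset.single_le_sum (f := fun x => w x * p.1 x)
          (fun y _ => mul_nonneg (hw y).le (h1 y)) (Finset.mem_univ x)).trans hV'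
      · show p.2.1 x ε t a ≤ 1
        rw [← h3 x ε t]
        exact Finset.single_le_sum (f := fun a => p.2.1 x ε t a)
          (fun y _ => h2 x ε t y) (Finset.mem_univ a)
      · show p.2.2 x a ≤ 1
        rw [← (hΦsub _ h4 x).2]
        exact Finset.single_le_sum (f := fun a => p.2.2 x a)
          (fun y _ => (hΦsub _ h4 x).1 y) (Finset.mem_univ a)
    obtain ⟨p, hp, hmin⟩ := hK.exists_isMinOn ⟨p0, hp0, le_refl V0⟩ hcont.continuousOn
    refine ⟨p, hp.1, fun p' hp' => ?_⟩
    by_cases h : ∑ x : X, w x * p'.1 x ≤ V0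
    · exact hmin ⟨hp', h⟩
    · exact le_trans hp.2 (not_le.mp h).le
  refine ⟨hatt, ?_⟩
  obtain ⟨p, hp, hmin⟩ := hatt
  have hleast : IsLeast ((fun p => ∑ x : X, w x * p.1 x) '' FeasibleSet ψ π u Φ)
      (∑ x : X, w x * p.1 x) := by
    refine ⟨⟨p, hp, rfl⟩, ?_⟩
    rintro _ ⟨p', hp', rfl⟩
    exact hmin p' hp'
  rw [hleast.csInf_eq]
  constructor
  · intro h0
    obtain ⟨h1, h2, h3, h4, h5, h6⟩ := hp
    have hq : ∀ x, p.1 x = 0 := by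
      intro x
      have := (Finset.sum_eq_zero_iff_of_nonneg
        (fun y _ => mul_nonneg (hw y).le (h1 y))).mp h0 x (Finset.mem_univ x)
      exact (mul_eq_zero.mp this).resolve_left (hw x).ne'
    refine ⟨p.2.1, h2, h3, fun x i ti a ai' => ?_, ?_⟩
    · have := h5 x i ti a ai'
      rwa [hq x] at this
    · convert h4 using 1
      funext x a
      exact (h6 x a).symm
  · rintro ⟨σ, h2, h3, h5, h4⟩
    apply le_antisymm
    · refine (hmin (fun _ => 0, σ, _) ⟨fun _ => le_refl _, h2, h3, h4,
        fun x i ti a ai' => h5 x i ti a ai', fun _ _ => rfl⟩).trans ?_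
      simp
    · exact Finset.sum_nonneg fun y _ => mul_nonneg (hw y).le (hp.1 y)
end
end

section
/- Let (G,S) be a finite game of incomplete information. A decision rule σ is a Bayes stable equilibrium of (G,S) if and only if there exist an expansion S* of S — given by finite nonempty sets T̃_i with T̃ = ∏_i T̃_i and an augmenting signal distribution λ : E × T → Δ(T̃) — and a rational expectations equilibrium δ : T × T̃ → Δ(A) of (G,S*) that induces σ, i.e. σ(a|ε,t) = ∑_{t̃∈T̃} λ(t̃|ε,t)·δ(a|(t,t̃)) for all a ∈ A whenever ψ(ε)·π(t|ε) > 0. (Paper's Lemma 1.) -/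
open Finset
open scoped Classical

noncomputable section

/-- A witness that the decision rule `σ` is induced by a rational expectations equilibrium
of `(G,S*)` for some expansion `S*` of `S`: finite nonempty sets of extra signals `Tt i`, an
augmenting signal distribution `lam`, and an outcome function `delta` of the expanded game
satisfying the rational expectations equilibrium conditions, such that
`σ(a|ε,t) = ∑_{t̃} λ(t̃|ε,t)·δ(a|(t,t̃))` whenever `ψ(ε)·π(t|ε) > 0`. -/
structure REEInducingWitness (I E : Type) (A T : I → Type) [Fintype I] [Fintype E]
    [∀ i, Fintype (A i)] [∀ i, Fintype (T i)]
    (ψ : E → ℝ) (π : E → (∀ i, T i) → ℝ)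
    (u : I → (∀ j, A j) → E → ℝ)
    (σ : E → (∀ i, T i) → (∀ i, A i) → ℝ) : Type 1 where
  /-- the extra signal set of each player -/
  Tt : I → Type
  [finTt : ∀ i, Fintype (Tt i)]
  [neTt : ∀ i, Nonempty (Tt i)]
  /-- the augmenting signal distribution `λ : E × T → Δ(T̃)` -/
  lam : E → (∀ i, T i) → (∀ i, Tt i) → ℝ
  lam_nonneg : ∀ ε t tt, 0 ≤ lam ε t tt
  lam_sum : ∀ ε t, ∑ tt : ∀ i, Tt i, lam ε t tt = 1
  /-- the outcome function `δ : T × T̃ → Δ(A)` of the expanded game -/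
  delta : (∀ i, T i) → (∀ i, Tt i) → (∀ i, A i) → ℝ
  delta_nonneg : ∀ t tt a, 0 ≤ delta t tt a
  delta_sum : ∀ t tt, ∑ a : ∀ i, A i, delta t tt a = 1
  /-- `delta` is a rational expectations equilibrium of `(G,S*)`, where `S*` has signal
  sets `T i × Tt i` and signal distribution `π*((t,t̃)|ε) = π(t|ε)·λ(t̃|ε,t)` -/
  ree : ∀ (i : I) (ti : T i) (tti : Tt i) (a : ∀ j, A j) (ai' : A i),
    ∑ ε : E, ∑ t ∈ Finset.univ.filter (fun t : ∀ j, T j => t i = ti),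
      ∑ tt ∈ Finset.univ.filter (fun tt : ∀ j, Tt j => tt i = tti),
        ψ ε * π ε t * lam ε t tt * delta t tt a *
          (u i (Function.update a i ai') ε - u i a ε) ≤ 0
  /-- `delta` induces `σ` at every `(ε,t)` of positive probability -/
  induces : ∀ ε t, 0 < ψ ε * π ε t →
    ∀ a, σ ε t a = ∑ tt : ∀ i, Tt i, lam ε t tt * delta t tt a

/-- **Lemma 1 of the paper.** A decision rule `σ` is a Bayes stable equilibrium of `(G,S)`
if and only if, for some expansion `S*` of `S`, there is a rational expectations
equilibrium of `(G,S*)` that induces `σ`. -/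
theorem isBSE_iff_nonempty_reeInducingWitness {I E : Type} {A T : I → Type}
    [Fintype I] [Nonempty I] [Fintype E] [Nonempty E]
    [∀ i, Fintype (A i)] [∀ i, Nonempty (A i)]
    [∀ i, Fintype (T i)] [∀ i, Nonempty (T i)]
    (ψ : E → ℝ) (π : E → (∀ i, T i) → ℝ)
    (u : I → (∀ j, A j) → E → ℝ)
    (σ : E → (∀ i, T i) → (∀ i, A i) → ℝ)
    (hψpos : ∀ ε, 0 < ψ ε) (hψsum : ∑ ε : E, ψ ε = 1)
    (hπnn : ∀ ε t, 0 ≤ π ε t) (hπsum : ∀ ε, ∑ t : ∀ i, T i, π ε t = 1)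
    (hσnn : ∀ ε t a, 0 ≤ σ ε t a) (hσsum : ∀ ε t, ∑ a : ∀ i, A i, σ ε t a = 1) :
    IsBSE ψ π u σ ↔ Nonempty (REEInducingWitness I E A T ψ π u σ) := by
  constructor
  · intro h
    obtain ⟨i0⟩ := ‹Nonempty I›
    have key : ∀ (ε : E) (t : ∀ i, T i) (f : (I → (∀ j, A j)) → ℝ),
        ∑ tt : I → (∀ j, A j),
          (∑ b : ∀ j, A j, if tt = (fun _ => b) then σ ε t b else 0) * f tt
          = ∑ b : ∀ j, A j, σ ε t b * f (fun _ => b) := by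
      intro ε t f
      simp_rw [Finset.sum_mul]
      rw [Finset.sum_comm]
      refine Finset.sum_congr rfl fun b _ => ?_
      simp [ite_mul]
    refine ⟨{ Tt := fun _ => ∀ j, A j
              lam := fun ε t tt => ∑ b : ∀ j, A j, if tt = (fun _ => b) then σ ε t b else 0
              lam_nonneg := ?_
              lam_sum := ?_
              delta := fun _ tt a => if tt i0 = a then 1 else 0
              delta_nonneg := ?_
              delta_sum := ?_
              ree := ?_
              induces := ?_ }⟩
    · intro ε t tt
      refine Finset.sum_nonneg fun b _ => ?_
      split_ifs
      · exact hσnn ε t b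
      · exact le_rfl
    · intro ε t
      have := key ε t (fun _ => 1)
      simp only [mul_one] at this
      rw [← hσsum ε t]
      exact this
    · intro t tt a
      split_ifs <;> norm_num
    · intro t tt
      simp
    · intro i ti tti a ai'
      have inner : ∀ (ε : E) (t : ∀ j, T j),
          ∑ tt ∈ Finset.univ.filter (fun tt : I → ∀ j, A j => tt i = tti),
            ψ ε * π ε t *
              (∑ b : ∀ j, A j, if tt = (fun _ => b) then σ ε t b else 0) *
              (if tt i0 = a then 1 else 0) *
              (u i (Function.update a i ai') ε - u i a ε)
          = if a = tti then ψ ε * π ε t * σ ε t a *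
              (u i (Function.update a i ai') ε - u i a ε) else 0 := by
        intro ε t
        have := key ε t (fun tt => if tt i = tti then (if tt i0 = a then
          ψ ε * π ε t * (u i (Function.update a i ai') ε - u i a ε) else 0) else 0)
        rw [Finset.sum_filter]
        trans
        · refine (Finset.sum_congr rfl fun tt _ => ?_).trans this
          split_ifs <;> ring
        · rw [Finset.sum_eq_single a]
          · simp only [if_true]
            split_ifs <;> ring
          · intro b _ hb
            simp [hb]
          · simp
      refine le_of_eq_of_le (Finset.sum_congr rfl fun ε _ =>
        Finset.sum_congr rfl fun t _ =>
          (?_ : _ = if a = tti then ψ ε * π ε t * σ ε t a *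
              (u i (Function.update a i ai') ε - u i a ε) else 0)) ?_
      · convert inner ε t
      by_cases hat : a = tti
      · simp only [hat, if_true]
        exact h i ti tti ai'
      · simp [hat]
    · intro ε t _ a
      have := key ε t (fun tt => if tt i0 = a then 1 else 0)
      refine Eq.trans ?_ this.symm
      simp
  · rintro ⟨w⟩ i ti a ai'
    letI := w.finTt
    have hsum := Finset.sum_nonpos (s := (Finset.univ : Finset (w.Tt i)))
      (fun tti _ => w.ree i ti tti a ai')
    refine le_of_eq_of_le ?_ hsum
    symm
    rw [Finset.sum_comm]
    refine Finset.sum_congr rfl fun ε _ => ?_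
    rw [Finset.sum_comm]
    refine Finset.sum_congr rfl fun t _ => ?_
    rw [Finset.sum_fiberwise Finset.univ (fun tt : ∀ j, w.Tt j => tt i)]
    symm
    rcases (mul_nonneg (hψpos ε).le (hπnn ε t)).eq_or_lt with h0 | h0
    · simp [← h0]
    · rw [w.induces ε t h0 a, Finset.mul_sum, Finset.sum_mul]
      refine Finset.sum_congr rfl fun tt _ => ?_
      ring
end
end

section
/- Let G be a finite basic game, let S² be an information structure with signal sets T_i and signal distribution π², and let S¹ be an expansion of S² given by finite nonempty sets T̃_i and an augmenting signal distribution λ : E × T → Δ(T̃), so that π¹((t,t̃)|ε) = π²(t|ε)·λ(t̃|ε,t). If σ¹ : E × (T × T̃) → Δ(A) is a Bayes stable equilibrium of (G,S¹), then the decision rule σ² : E × T → Δ(A) defined by σ²(a|ε,t) = ∑_{t̃∈T̃} λ(t̃|ε,t)·σ¹(a|ε,(t,t̃)) is a Bayes stable equilibrium of (G,S²). Moreover, σ¹ and σ² induce the same action distribution φ(a) = ∑_{ε,t,t̃} ψ(ε)·π¹((t,t̃)|ε)·σ¹(a|ε,(t,t̃)) = ∑_{ε,t} ψ(ε)·π²(t|ε)·σ²(a|ε,t).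 (Key lemma in the proof of the paper's Theorem 5.1: a BSE under a more informative information structure induces a BSE under a less informative one.) -/
open Finset
open scoped Classical

noncomputable section

/-- Sum over profiles of pairs equals the double sum over pairs of profiles. -/
theorem sum_pair_profile {I : Type} {T Tt : I → Type} [Fintype I]
    [∀ i, Fintype (T i)] [∀ i, Fintype (Tt i)] (F : (∀ i, T i × Tt i) → ℝ) :
    ∑ s : ∀ i, T i × Tt i, F s
      = ∑ t : ∀ i, T i, ∑ tt : ∀ i, Tt i, F (fun i => (t i, tt i)) := by
  rw [← Fintype.sum_prod_type' (f := fun (t : ∀ i, T i) (tt : ∀ i, Tt i) =>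
    F (fun i => (t i, tt i)))]
  let e : (∀ i, T i × Tt i) ≃ (∀ i, T i) × (∀ i, Tt i) :=
    { toFun := fun s => (fun i => (s i).1, fun i => (s i).2)
      invFun := fun p i => (p.1 i, p.2 i)
      left_inv := fun _ => rfl
      right_inv := fun _ => rfl }
  exact Fintype.sum_equiv e _ _ (fun _ => rfl)

/-- **Key lemma in the proof of Theorem 5.1 of the paper.** Let `S¹` be the expansion of
`S²` determined by extra signal sets `Tt i` and the augmenting signal distribution `lam`,
so that `π¹((t,t̃)|ε) = π²(t|ε)·λ(t̃|ε,t)`. If `σ¹` is a Bayes stable equilibrium of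
`(G,S¹)`, then the decision rule `σ²(a|ε,t) = ∑_{t̃} λ(t̃|ε,t)·σ¹(a|ε,(t,t̃))` is a Bayes
stable equilibrium of `(G,S²)`, and `σ¹` and `σ²` induce the same distribution over
action profiles. -/
theorem bse_of_expansion_bse {I E : Type} {A T Tt : I → Type}
    [Fintype I] [Nonempty I] [Fintype E] [Nonempty E]
    [∀ i, Fintype (A i)] [∀ i, Nonempty (A i)]
    [∀ i, Fintype (T i)] [∀ i, Nonempty (T i)]
    [∀ i, Fintype (Tt i)] [∀ i, Nonempty (Tt i)]
    (ψ : E → ℝ) (hψpos : ∀ ε, 0 < ψ ε) (hψsum : ∑ ε : E, ψ ε = 1)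
    (u : I → (∀ j, A j) → E → ℝ)
    (π2 : E → (∀ i, T i) → ℝ)
    (hπ2nn : ∀ ε t, 0 ≤ π2 ε t) (hπ2sum : ∀ ε, ∑ t : ∀ i, T i, π2 ε t = 1)
    (lam : E → (∀ i, T i) → (∀ i, Tt i) → ℝ)
    (hlamnn : ∀ ε t tt, 0 ≤ lam ε t tt)
    (hlamsum : ∀ ε t, ∑ tt : ∀ i, Tt i, lam ε t tt = 1)
    (π1 : E → (∀ i, T i × Tt i) → ℝ)
    (hπ1 : ∀ ε s, π1 ε s = π2 ε (fun i => (s i).1) * lam ε (fun i => (s i).1) (fun i => (s i).2))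
    (σ1 : E → (∀ i, T i × Tt i) → (∀ i, A i) → ℝ)
    (hσ1nn : ∀ ε s a, 0 ≤ σ1 ε s a) (hσ1sum : ∀ ε s, ∑ a : ∀ i, A i, σ1 ε s a = 1)
    (hBSE1 : IsBSE ψ π1 u σ1)
    (σ2 : E → (∀ i, T i) → (∀ i, A i) → ℝ)
    (hσ2 : ∀ ε t a, σ2 ε t a = ∑ tt : ∀ i, Tt i, lam ε t tt * σ1 ε (fun i => (t i, tt i)) a) :
    ((∀ ε t a, 0 ≤ σ2 ε t a) ∧ (∀ ε t, ∑ a : ∀ i, A i, σ2 ε t a = 1)) ∧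
    IsBSE ψ π2 u σ2 ∧
    (∀ a, ∑ ε : E, ∑ s : ∀ i, T i × Tt i, ψ ε * π1 ε s * σ1 ε s a
        = ∑ ε : E, ∑ t : ∀ i, T i, ψ ε * π2 ε t * σ2 ε t a) := by
  refine ⟨⟨?_, ?_⟩, ?_, ?_⟩
  · intro ε t a
    rw [hσ2]
    exact Finset.sum_nonneg fun tt _ => mul_nonneg (hlamnn _ _ _) (hσ1nn _ _ _)
  · intro ε t
    simp_rw [hσ2]
    rw [Finset.sum_comm]
    simp_rw [← Finset.mul_sum, hσ1sum, mul_one]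
    exact hlamsum ε t
  · intro i ti a ai'
    have h : ∑ tti : Tt i, ∑ ε : E,
        ∑ s ∈ Finset.univ.filter (fun s : ∀ j, T j × Tt j => s i = (ti, tti)),
          ψ ε * π1 ε s * σ1 ε s a *
            (u i (Function.update a i ai') ε - u i a ε) ≤ 0 :=
      Finset.sum_nonpos fun tti _ => by
        refine le_of_eq_of_le ?_ (hBSE1 i (ti, tti) a ai')
        congr!
    refine le_of_eq_of_le ?_ h
    refine Eq.trans ?_ Finset.sum_comm
    refine Finset.sum_congr rfl fun ε _ => ?_
    simp_rw [Finset.sum_filter]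
    refine Eq.trans ?_ Finset.sum_comm
    rw [sum_pair_profile]
    refine Finset.sum_congr rfl fun t _ => ?_
    simp_rw [Prod.mk.injEq]
    by_cases ht : t i = ti
    · simp only [ht, true_and, if_true, Finset.sum_ite_eq, Finset.mem_univ, hσ2, hπ1,
        Finset.mul_sum, Finset.sum_mul]
      refine Finset.sum_congr rfl fun tt _ => ?_
      ring
    · simp [ht]
  · intro a
    refine Finset.sum_congr rfl fun ε _ => ?_
    rw [sum_pair_profile]
    refine Finset.sum_congr rfl fun t _ => ?_
    simp only [hσ2, hπ1, Finset.mul_sum]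
    refine Finset.sum_congr rfl fun tt _ => ?_
    ring
end
end
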